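/- Let K be a perfect field of characteristic different from 2, let t ≥ 1, and let f_0, …, f_t ∈ K^× be units with f_0 + f_1 + ⋯ + f_t = 0. Then in the Milnor-Witt K-theory K^MW_*(K) one has ⟨−f_0⟩^t · [−f_1/f_0] [−f_2/f_0] ⋯ [−f_t/f_0] = R(f_0, …, f_t). -/

import Mathlib

/-!
Milnor-Witt K-theory of a field `K`, presented as the quotient of the free
(associative, unital) `ℤ`-algebra on generators `[a]` (for `a ∈ Kˣ`, degree 1)
and `η` (degree `-1`) by the Milnor-Witt relations.
-/

namespace MWStatement

variable (K : Type) [Field K]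

/-- The free `ℤ`-algebra on the generators of Milnor-Witt K-theory:
`none` stands for `η` and `some a` for the symbol `[a]`, `a ∈ Kˣ`. -/
abbrev Pre := FreeAlgebra ℤ (Option Kˣ)

/-- The generator `η`. -/
noncomputable def preEta : Pre K := FreeAlgebra.ι ℤ (none : Option Kˣ)

/-- The symbol `[a]` for a unit `a`. -/
noncomputable def preSym (a : Kˣ) : Pre K := FreeAlgebra.ι ℤ (some a)

/-- The defining relations of Milnor-Witt K-theory. -/
inductive Rel : Pre K → Pre K → Prop
  | steinberg (a : Kˣ) (h : (a : K) ≠ 1) :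
      Rel (preSym K a * preSym K (Units.mk0 (1 - (a : K)) (sub_ne_zero_of_ne (Ne.symm h)))) 0
  | mulSym (a b : Kˣ) :
      Rel (preSym K (a * b)) (preSym K a + preSym K b + preEta K * preSym K a * preSym K b)
  | etaComm (a : Kˣ) : Rel (preEta K * preSym K a) (preSym K a * preEta K)
  | hyperbolic : Rel (preEta K * ((2 : Pre K) + preEta K * preSym K (-1))) 0

/-- Milnor-Witt K-theory `K^MW_*(K)` (as a ring, forgetting the grading). -/
abbrev KMW := RingQuot (Rel K)

/-- The class of `η` in Milnor-Witt K-theory. -/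
noncomputable def eta : KMW K := RingQuot.mkRingHom (Rel K) (preEta K)

/-- The class of the symbol `[a]` in Milnor-Witt K-theory. -/
noncomputable def sym (a : Kˣ) : KMW K := RingQuot.mkRingHom (Rel K) (preSym K a)

/-- `⟨a⟩ = 1 + η [a]`. -/
noncomputable def gw (a : Kˣ) : KMW K := 1 + eta K * sym K a

/-- `ε = -⟨-1⟩ = -(1 + η [-1])`. -/
noncomputable def eps : KMW K := -(gw K (-1))

/-- The ordered product `[f j₁] ⋯ [f jₘ]` over the indices `j ∉ s`, taken in
increasing order of indices. -/
noncomputable def prodOmit {t : ℕ} (f : Fin t → Kˣ) (s : Finset (Fin t)) : KMW K :=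
  (((List.finRange t).filter fun j => decide (j ∉ s)).map fun j => sym K (f j)).prod

/-- The element `R(f 0, …, f t)`, namely
`Σ_{i=0}^{t} ε^{t+i} [f 0]⋯\widehat{[f i]}⋯[f t] +
 Σ_{k=1}^{t} Σ_{0 ≤ i₀ < ⋯ < i_k ≤ t} (−1)^k [−1]^k
   [f 0]⋯\widehat{[f i₀]}⋯\widehat{[f i_k]}⋯[f t]`,
where hats denote omitted factors (the second sum is indexed by the subsets
`s = {i₀ < ⋯ < i_k}` of cardinality `k + 1 ≥ 2` of omitted indices). -/
noncomputable def Rsym {t : ℕ} (f : Fin (t + 1) → Kˣ) : KMW K :=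
  (∑ i : Fin (t + 1), eps K ^ (t + (i : ℕ)) * prodOmit K f {i}) +
    ∑ s ∈ Finset.univ.powerset.filter (fun s : Finset (Fin (t + 1)) => 2 ≤ s.card),
      (-1 : KMW K) ^ (s.card - 1) * sym K (-1) ^ (s.card - 1) * prodOmit K f s

section

variable {K}

/-- The ring structure of `KMW K`, presented so that its semiring part is syntactically
`RingQuot.instSemiring`. -/
local instance instRingKMW : Ring (KMW K) :=
  { RingQuot.instSemiring (Rel K), RingQuot.instRing (Rel K) with }

lemma sym_mul (a b : Kˣ) : sym K (a * b) = sym K a + sym K b + eta K * sym K a * sym K b := by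
  simpa only [map_add, map_mul, sym, eta] using RingQuot.mkRingHom_rel (Rel.mulSym a b)

lemma eta_comm (a : Kˣ) : eta K * sym K a = sym K a * eta K := by
  simpa only [map_mul, sym, eta] using RingQuot.mkRingHom_rel (Rel.etaComm a)

lemma eta_mul_hyperbolic : eta K * (2 + eta K * sym K (-1)) = 0 := by
  simpa only [map_add, map_mul, map_zero, map_ofNat, sym, eta] using
    RingQuot.mkRingHom_rel (Rel.hyperbolic (K := K))

lemma sym_mul_sym_of_add_eq_one {a b : Kˣ} (h : (a : K) + b = 1) : sym K a * sym K b = 0 := by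
  have ha : (a : K) ≠ 1 := fun h1 => b.ne_zero (by simp [h1] at h)
  have hb : Units.mk0 (1 - (a : K)) (sub_ne_zero_of_ne (Ne.symm ha)) = b :=
    Units.ext (by simp [← h])
  simpa only [map_mul, map_zero, hb, sym] using RingQuot.mkRingHom_rel (Rel.steinberg a ha)

lemma sym_mul_eq (a b : Kˣ) : sym K (a * b) = sym K a + gw K a * sym K b := by
  rw [sym_mul, gw]; noncomm_ring

lemma eta_mul_sym_comm (a b : Kˣ) : eta K * sym K a * sym K b = eta K * sym K b * sym K a := by
  have h := sym_mul a b
  rw [mul_comm a b, sym_mul b a, add_comm (sym K b)] at h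
  exact (add_left_cancel h).symm

lemma gw_comm_sym (a b : Kˣ) : gw K a * sym K b = sym K b * gw K a := by
  rw [gw, add_mul, mul_add, ← mul_assoc, ← eta_comm, eta_mul_sym_comm, one_mul, mul_one]

lemma gw_mul (a b : Kˣ) : gw K (a * b) = gw K a * gw K b := by
  have h : gw K a * gw K b = gw K a + eta K * (gw K a * sym K b) := by
    have : gw K a * eta K = eta K * gw K a := by
      simp only [gw, add_mul, mul_add, one_mul, mul_one, mul_assoc, ← eta_comm]
    rw [← mul_assoc, ← this, mul_assoc, show gw K b = 1 + eta K * sym K b from rfl, mul_add, mul_one]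
  rw [h, gw, sym_mul_eq, gw]; noncomm_ring

lemma sym_one : sym K 1 = 0 := by
  have h1 : sym K 1 = (2 + eta K * sym K (-1)) * sym K (-1) := by
    have h := sym_mul (-1 : Kˣ) (-1)
    rw [neg_mul_neg, one_mul] at h
    rw [h]; noncomm_ring
  have h2 : eta K * sym K 1 = 0 := by
    rw [h1, ← mul_assoc, eta_mul_hyperbolic, zero_mul]
  have h := sym_mul (1 : Kˣ) 1
  rw [mul_one, h2, zero_mul, add_zero] at h
  exact left_eq_add.mp h

lemma gw_one : gw K 1 = 1 := by rw [gw, sym_one, mul_zero, add_zero]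

lemma gw_inv_mul_gw (a : Kˣ) : gw K a⁻¹ * gw K a = 1 := by rw [← gw_mul, inv_mul_cancel, gw_one]

lemma sym_eq_neg_gw_mul_sym_inv (a : Kˣ) : sym K a = -(gw K a * sym K a⁻¹) := by
  rw [eq_neg_iff_add_eq_zero, ← sym_mul_eq, mul_inv_cancel, sym_one]

lemma sym_mul_sym_neg (a : Kˣ) : sym K a * sym K (-a) = 0 := by
  by_cases ha : a = 1
  · rw [ha, sym_one, zero_mul]
  have ha' : (1 : K) - a ≠ 0 := sub_ne_zero_of_ne fun h => ha (Units.ext h.symm)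
  have hi' : (1 : K) - (a⁻¹ : Kˣ) ≠ 0 :=
    sub_ne_zero_of_ne fun h => ha (inv_eq_one.mp (Units.ext h.symm))
  have hmul : Units.mk0 _ ha' = -a * Units.mk0 _ hi' := by
    ext; simp [mul_sub]
  have h1 : sym K a * sym K (Units.mk0 _ ha') = 0 := sym_mul_sym_of_add_eq_one (by simp)
  have h2 : sym K a⁻¹ * sym K (Units.mk0 _ hi') = 0 := sym_mul_sym_of_add_eq_one (by simp)
  have h3 : sym K a * sym K (Units.mk0 _ hi') = 0 := by
    rw [sym_eq_neg_gw_mul_sym_inv, neg_mul, mul_assoc, h2, mul_zero, neg_zero]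
  rwa [hmul, sym_mul_eq, mul_add, ← mul_assoc, ← gw_comm_sym, mul_assoc, h3, mul_zero,
    add_zero] at h1

lemma sym_neg (a : Kˣ) : sym K (-a) = sym K (-1) - eps K * sym K a := by
  rw [← neg_one_mul, sym_mul_eq, eps]; noncomm_ring

lemma eps_mul_eps : eps K * eps K = 1 := by
  rw [eps, neg_mul_neg, ← gw_mul, neg_mul_neg, one_mul, gw_one]

lemma eps_comm (a : Kˣ) : Commute (eps K) (sym K a) := by
  rw [eps]; exact Commute.neg_left (gw_comm_sym _ _)

lemma sym_mul_self (a : Kˣ) : sym K a * sym K a = sym K (-1) * sym K a := by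
  have h : sym K a = sym K (-1) - eps K * sym K (-a) := by rw [← sym_neg, neg_neg]
  have h0 := sym_mul_sym_neg (-a)
  rw [neg_neg] at h0
  conv_lhs => enter [1]; rw [h]
  rw [sub_mul, mul_assoc, h0, mul_zero, sub_zero]

lemma sym_anticomm (a b : Kˣ) : sym K a * sym K b = eps K * (sym K b * sym K a) := by
  have hb : gw K (-b) * sym K b = sym K b := by
    have h0 := sym_mul_sym_neg (-b)
    rw [neg_neg] at h0
    rw [gw, add_mul, one_mul, mul_assoc, h0, mul_zero, add_zero]
  have hab : sym K a * sym K (-(a * b)) = gw K (-a) * (sym K a * sym K b) := by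
    rw [← neg_mul, sym_mul_eq, mul_add, sym_mul_sym_neg, zero_add, ← mul_assoc, ← gw_comm_sym,
      mul_assoc]
  have hba : sym K b * sym K (-(a * b)) = sym K b * sym K a := by
    rw [mul_comm, ← neg_mul, sym_mul_eq, mul_add, sym_mul_sym_neg, zero_add, ← mul_assoc,
      ← gw_comm_sym, hb]
  have h := sym_mul_sym_neg (a * b)
  rw [sym_mul_eq a b, add_mul, mul_assoc, hab, hba, ← mul_neg_one a, gw_mul, mul_assoc,
    ← mul_add] at h
  have h' : gw K (-1) * (sym K a * sym K b) + sym K b * sym K a = 0 := by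
    rw [← one_mul (_ + _), ← gw_inv_mul_gw a, mul_assoc, h, mul_zero]
  rw [← one_mul (sym K a * sym K b), ← eps_mul_eps, mul_assoc, eq_neg_of_add_eq_zero_right h', eps,
    neg_mul, neg_mul, neg_mul, mul_neg]

lemma eps_mul_sym_neg_one : eps K * sym K (-1) = sym K (-1) := by
  have h := sym_neg (-1 : Kˣ)
  rw [neg_neg, sym_one] at h
  exact (sub_eq_zero.mp h.symm).symm

lemma sym_neg_one_comm (a : Kˣ) : Commute (sym K (-1)) (sym K a) := by
  rw [Commute, SemiconjBy, sym_anticomm, ← mul_assoc, (eps_comm a).eq, mul_assoc,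
    eps_mul_sym_neg_one]

/-- A product of two symbols is a left multiple of the symbol of the sum of their entries. -/
lemma exists_sym_mul_sym_eq {a b s : Kˣ} (h : (a : K) + b = s) :
    ∃ z, sym K a * sym K b = z * sym K s := by
  obtain ⟨x, rfl⟩ : ∃ x, a = s * x := ⟨s⁻¹ * a, by simp⟩
  obtain ⟨y, rfl⟩ : ∃ y, b = s * y := ⟨s⁻¹ * b, by simp⟩
  have hxy : sym K x * sym K y = 0 := sym_mul_sym_of_add_eq_one
    (mul_left_cancel₀ s.ne_zero (by simpa [mul_add] using h))
  refine ⟨sym K (-1) + gw K s * (eps K * sym K y) + gw K s * sym K x, ?_⟩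
  rw [sym_mul_eq s x, sym_mul_eq s y, add_mul, mul_add, mul_add, sym_mul_self, ← mul_assoc,
    ← gw_comm_sym, mul_assoc (gw K s), sym_anticomm s y, mul_assoc (gw K s) _ (gw K s * _),
    ← mul_assoc (sym K x), ← gw_comm_sym s x, mul_assoc (gw K s) (sym K x) (sym K y), hxy]
  noncomm_ring

/-- The Steinberg relation for arbitrarily many entries. -/
lemma prod_sym_eq_zero_of_sum_eq_one (l : List Kˣ) (h : (l.map Units.val).sum = 1) :
    (l.map (sym K)).prod = 0 := by
  induction hn : l.length generalizing l with
  | zero => simp_all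
  | succ n ih =>
    match l, hn with
    | [a], _ =>
      have ha : a = 1 := Units.ext (by simpa using h)
      simp [ha, sym_one]
    | a :: b :: l, hn =>
      simp only [List.map_cons, List.prod_cons, List.sum_cons] at h ⊢
      rw [← mul_assoc]
      by_cases hs : (a : K) + b = 0
      · have hb : b = -a := Units.ext (by simpa using (neg_eq_of_add_eq_zero_right hs).symm)
        rw [hb, sym_mul_sym_neg, zero_mul]
      · obtain ⟨z, hz⟩ := exists_sym_mul_sym_eq (s := Units.mk0 _ hs) rfl
        have h0 := ih (Units.mk0 _ hs :: l) (by simpa [add_assoc] using h) (by simpa using hn)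
        rw [List.map_cons, List.prod_cons] at h0
        rw [hz, mul_assoc, h0, mul_zero]

lemma prod_gw_mul_sym (u : Kˣ) {t : ℕ} (g : Fin t → Kˣ) :
    gw K u ^ t * (List.ofFn fun i => sym K (g i)).prod =
      (List.ofFn fun i => sym K (u * g i) - sym K u).prod := by
  induction t with
  | zero => simp
  | succ t ih =>
    have hc : Commute (gw K u ^ t) (sym K (g 0)) := Commute.pow_left (gw_comm_sym _ _) t
    rw [List.ofFn_succ, List.ofFn_succ, List.prod_cons, List.prod_cons, ← ih, sym_mul_eq,
      add_sub_cancel_left, pow_succ', mul_assoc, ← mul_assoc (gw K u ^ t), hc.eq]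
    simp only [mul_assoc]

lemma sum_finset_fin_succ {M : Type*} [AddCommMonoid M] {t : ℕ} (F : Finset (Fin (t + 1)) → M) :
    ∑ s, F s = ∑ s : Finset (Fin t), F (s.map (Fin.succEmb t)) +
      ∑ s : Finset (Fin t), F (insert 0 (s.map (Fin.succEmb t))) := by
  have hsucc : (⟨Fin.succ, Fin.succ_injective t⟩ : Fin t ↪ Fin (t + 1)) = Fin.succEmb t := rfl
  have hinj : Set.InjOn (Finset.image (Fin.succEmb t)) (Finset.univ : Finset (Finset (Fin t))) :=
    (Finset.image_injective (Fin.succEmb t).injective).injOn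
  rw [← Finset.powerset_univ, Fin.univ_succ, Finset.cons_eq_insert, hsucc,
    Finset.sum_powerset_insert (by simp), Finset.map_eq_image, Finset.powerset_image,
    Finset.powerset_univ]
  simp only [Finset.map_eq_image]
  rw [Finset.sum_image hinj, Finset.sum_image hinj]

lemma prodOmit_map_succ {t : ℕ} (f : Fin (t + 1) → Kˣ) (s : Finset (Fin t)) :
    prodOmit K f (s.map (Fin.succEmb t)) = sym K (f 0) * prodOmit K (Fin.tail f) s := by
  simp [prodOmit, List.finRange_succ, List.filter_map, Function.comp_def, Fin.tail]

lemma prodOmit_insert_zero {t : ℕ} (f : Fin (t + 1) → Kˣ) (s : Finset (Fin t)) :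
    prodOmit K f (insert 0 (s.map (Fin.succEmb t))) = prodOmit K (Fin.tail f) s := by
  simp [prodOmit, List.finRange_succ, List.filter_map, Function.comp_def, Fin.tail]

/-- The sum of the products of symbols over all sets of omitted indices, weighted by a function
of the number of omitted indices. -/
noncomputable def omitSum (φ : ℕ → KMW K) {t : ℕ} (f : Fin t → Kˣ) : KMW K :=
  ∑ s : Finset (Fin t), φ s.card * prodOmit K f s

lemma omitSum_succ {φ : ℕ → KMW K} (hφ : ∀ k a, Commute (φ k) (sym K a)) {t : ℕ}
    (f : Fin (t + 1) → Kˣ) :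
    omitSum φ f = sym K (f 0) * omitSum φ (Fin.tail f) +
      omitSum (fun k => φ (k + 1)) (Fin.tail f) := by
  rw [omitSum, sum_finset_fin_succ, omitSum, omitSum, Finset.mul_sum]
  congr 1
  · refine Finset.sum_congr rfl fun s _ => ?_
    rw [prodOmit_map_succ, Finset.card_map, ← mul_assoc, (hφ _ _).eq, mul_assoc]
  · refine Finset.sum_congr rfl fun s _ => ?_
    rw [prodOmit_insert_zero, Finset.card_insert_of_notMem (by simp), Finset.card_map]

/-- The alternating sum of the products of all but one of the symbols. -/
noncomputable def altSum {t : ℕ} (f : Fin t → Kˣ) : KMW K :=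
  ∑ i : Fin t, eps K ^ (i : ℕ) * prodOmit K f {i}

lemma altSum_succ {t : ℕ} (f : Fin (t + 1) → Kˣ) :
    altSum f = prodOmit K (Fin.tail f) ∅ + eps K * (sym K (f 0) * altSum (Fin.tail f)) := by
  rw [altSum, Fin.sum_univ_succ, altSum, Finset.mul_sum, Finset.mul_sum]
  congr 1
  · have h := prodOmit_insert_zero f ∅
    rw [Finset.map_empty, insert_empty_eq] at h
    rw [h, Fin.val_zero, pow_zero, one_mul]
  · refine Finset.sum_congr rfl fun i _ => ?_
    have h := prodOmit_map_succ f {i}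
    rw [Finset.map_singleton, Fin.coe_succEmb] at h
    rw [h, Fin.val_succ, pow_succ', mul_assoc, ← mul_assoc _ (sym K (f 0)),
      ((eps_comm (f 0)).pow_left _).eq, mul_assoc]

/-- The weight of the sets of at least two omitted indices in `Rsym`. -/
noncomputable def multiWeight (K : Type) [Field K] (k : ℕ) : KMW K :=
  if 2 ≤ k then (-sym K (-1)) ^ (k - 1) else 0

lemma neg_sym_neg_one_pow_comm (k : ℕ) (a : Kˣ) : Commute ((-sym K (-1)) ^ k) (sym K a) :=
  (sym_neg_one_comm a).neg_left.pow_left k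

lemma multiWeight_comm (k : ℕ) (a : Kˣ) : Commute (multiWeight K k) (sym K a) := by
  rw [multiWeight]
  split_ifs
  · exact neg_sym_neg_one_pow_comm _ _
  · exact Commute.zero_left _

lemma eps_mul_multiWeight (k : ℕ) : eps K * multiWeight K k = multiWeight K k := by
  rw [multiWeight]
  split_ifs with hk
  · obtain ⟨j, rfl⟩ := Nat.exists_eq_add_of_le hk
    rw [show 2 + j - 1 = j + 1 by omega, pow_succ', ← mul_assoc, mul_neg, eps_mul_sym_neg_one]
  · exact mul_zero _

lemma eps_mul_omitSum_multiWeight {t : ℕ} (f : Fin t → Kˣ) :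
    eps K * omitSum (multiWeight K) f = omitSum (multiWeight K) f := by
  rw [omitSum, Finset.mul_sum]
  exact Finset.sum_congr rfl fun s _ => by rw [← mul_assoc, eps_mul_multiWeight]

lemma prodOmit_empty_add_omitSum {t : ℕ} (f : Fin t → Kˣ) :
    prodOmit K f ∅ + omitSum (fun k => multiWeight K (k + 1)) f =
      omitSum (fun k => (-sym K (-1)) ^ k) f := by
  rw [omitSum, omitSum, ← Finset.add_sum_erase _ _ (Finset.mem_univ (∅ : Finset (Fin t))),
    ← Finset.add_sum_erase _ _ (Finset.mem_univ (∅ : Finset (Fin t)))]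
  rw [Finset.card_empty, pow_zero, one_mul, multiWeight, if_neg (by norm_num), zero_mul, zero_add]
  congr 1
  refine Finset.sum_congr rfl fun s hs => ?_
  have hs' : 0 < s.card := Finset.card_pos.mpr
    (Finset.nonempty_iff_ne_empty.mpr (Finset.ne_of_mem_erase hs))
  rw [multiWeight, if_pos (by omega), Nat.add_sub_cancel]

lemma omitSum_neg_sym_neg_one_pow_succ {t : ℕ} (f : Fin (t + 1) → Kˣ) :
    omitSum (fun k => (-sym K (-1)) ^ k) f =
      (sym K (f 0) - sym K (-1)) * omitSum (fun k => (-sym K (-1)) ^ k) (Fin.tail f) := by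
  rw [omitSum_succ neg_sym_neg_one_pow_comm, sub_eq_add_neg, add_mul]
  congr 1
  simp only [omitSum, Finset.mul_sum, pow_succ', mul_assoc]

/-- `Rsym` normalised so that the first summand carries the coefficient `1`. -/
noncomputable def normRsym {t : ℕ} (f : Fin t → Kˣ) : KMW K :=
  altSum f + omitSum (multiWeight K) f

lemma normRsym_succ {t : ℕ} (f : Fin (t + 1) → Kˣ) :
    normRsym f = omitSum (fun k => (-sym K (-1)) ^ k) (Fin.tail f) +
      eps K * (sym K (f 0) * normRsym (Fin.tail f)) := by
  have h : eps K * (sym K (f 0) * omitSum (multiWeight K) (Fin.tail f)) =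
      sym K (f 0) * omitSum (multiWeight K) (Fin.tail f) := by
    rw [← mul_assoc, (eps_comm _).eq, mul_assoc, eps_mul_omitSum_multiWeight]
  rw [normRsym, altSum_succ, omitSum_succ multiWeight_comm, ← prodOmit_empty_add_omitSum, normRsym,
    mul_add, mul_add, h]
  abel

lemma prod_sym_sub_sym_neg (a : Kˣ) {t : ℕ} (g : Fin t → Kˣ) :
    (List.ofFn fun i => sym K (g i) - sym K (-a)).prod =
      omitSum (fun k => (-sym K (-1)) ^ k) g + eps K * (sym K a * normRsym g) := by
  induction t with
  | zero => simp [omitSum, normRsym, altSum, multiWeight, prodOmit, Finset.univ_unique,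
      Finset.eq_empty_of_isEmpty]
  | succ t ih =>
    have h := ih (Fin.tail g)
    simp only [Fin.tail] at h
    rw [List.ofFn_succ, List.prod_cons, h, omitSum_neg_sym_neg_one_pow_succ, normRsym_succ, sym_neg]
    change _ * (omitSum _ (Fin.tail g) + eps K * (sym K a * normRsym (Fin.tail g))) = _
    generalize omitSum _ (Fin.tail g) = q
    generalize normRsym (Fin.tail g) = r
    have key : (sym K (g 0) - (sym K (-1) - eps K * sym K a)) * (eps K * (sym K a * r)) =
        eps K * (sym K a * (eps K * (sym K (g 0) * r))) := by
      have h1 : sym K (g 0) * (eps K * (sym K a * r)) =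
          eps K * (sym K a * (eps K * (sym K (g 0) * r))) := by
        rw [← mul_assoc, ← (eps_comm _).eq, mul_assoc, ← mul_assoc _ _ r, sym_anticomm,
          ← mul_assoc (sym K a) (eps K), ← (eps_comm a).eq]
        simp only [mul_assoc]
      have h2 : sym K (-1) * (eps K * (sym K a * r)) = sym K (-1) * (sym K a * r) := by
        rw [← mul_assoc, ← (eps_comm _).eq, eps_mul_sym_neg_one]
      have h3 : eps K * sym K a * (eps K * (sym K a * r)) = sym K (-1) * (sym K a * r) := by
        rw [(eps_comm a).eq, mul_assoc, ← mul_assoc (eps K), eps_mul_eps, one_mul, ← mul_assoc,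
          sym_mul_self, mul_assoc]
      rw [sub_mul, sub_mul, h1, h2, h3, sub_self, sub_zero]
    rw [mul_add, key]
    noncomm_ring

lemma normRsym_eq_prod {t : ℕ} (f : Fin (t + 1) → Kˣ) :
    normRsym f = (List.ofFn fun i : Fin t => sym K (f i.succ) - sym K (-f 0)).prod := by
  rw [normRsym_succ, ← prod_sym_sub_sym_neg]; rfl

lemma Rsym_eq_eps_pow_mul_normRsym {t : ℕ} (f : Fin (t + 1) → Kˣ) :
    Rsym K f = eps K ^ t * normRsym f := by
  have h : ∀ n : ℕ, eps K ^ n * omitSum (multiWeight K) f = omitSum (multiWeight K) f := by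
    intro n
    induction n with
    | zero => rw [pow_zero, one_mul]
    | succ n ih => rw [pow_succ, mul_assoc, eps_mul_omitSum_multiWeight, ih]
  rw [normRsym, mul_add, h, Rsym, altSum, Finset.mul_sum, omitSum, Finset.powerset_univ,
    Finset.sum_filter]
  congr 1
  · exact Finset.sum_congr rfl fun i _ => by rw [pow_add, mul_assoc]
  · refine Finset.sum_congr rfl fun s _ => ?_
    rw [multiWeight, ite_mul, zero_mul, neg_pow (sym K (-1))]

end

end MWStatement

open MWStatement in
/-- Let `K` be a perfect field of characteristic `≠ 2`, `t ≥ 1`, and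
`f 0, …, f t ∈ Kˣ` units with `f 0 + f 1 + ⋯ + f t = 0`.  Then in `K^MW_*(K)` one has
`⟨−f 0⟩^t · [−f 1/f 0] [−f 2/f 0] ⋯ [−f t/f 0] = R(f 0, …, f t)`. -/
theorem statement3 (K : Type) [Field K] [PerfectField K] (hchar : (2 : K) ≠ 0)
    (t : ℕ) (ht : 1 ≤ t) (f : Fin (t + 1) → Kˣ) (hsum : ∑ i, (f i : K) = 0) :
    gw K (-(f 0)) ^ t *
        (List.ofFn fun i : Fin t => sym K (-(f i.succ) * (f 0)⁻¹)).prod =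
      Rsym K f := by
  have hsum' :
      ((List.ofFn fun i : Fin t => -(f i.succ) * (f 0)⁻¹).map Units.val).sum = 1 := by
    rw [Fin.sum_univ_succ] at hsum
    rw [List.map_ofFn, List.sum_ofFn]
    simp only [Function.comp_apply, Units.val_mul, Units.val_neg]
    rw [← Finset.sum_mul, Finset.sum_neg_distrib, neg_eq_of_add_eq_zero_left hsum,
      Units.mul_inv]
  have h0 : (List.ofFn fun i : Fin t => sym K (-(f i.succ) * (f 0)⁻¹)).prod = 0 := by
    have h := prod_sym_eq_zero_of_sum_eq_one _ hsum'
    rwa [List.map_ofFn] at h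
  have h1 := prod_gw_mul_sym (-(f 0)) fun i : Fin t => -(f i.succ) * (f 0)⁻¹
  simp only [mul_comm _ (f 0)⁻¹, neg_mul_comm, mul_neg, neg_neg, mul_inv_cancel_left] at h1
  rw [Rsym_eq_eps_pow_mul_normRsym, normRsym_eq_prod, ← h1]
  simp only [mul_comm _ (f 0)⁻¹, mul_neg] at h0 ⊢
  rw [h0, mul_zero, mul_zero]
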